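/- arXiv:2406.11841 — 2 statements merged into one kernel-verified Lean document; each statement's English description precedes it below -/
import Mathlib

section
/- Let N_02 be the 4-dimensional ℂ-algebra with basis e_1,e_2,e_3,e_4 and only nonzero basis products e_1e_1 = e_3 and e_2e_2 = e_4. Each of the six bilinear forms Δ₁₂+Δ₂₁, Δ₁₃+Δ₃₁, Δ₂₄+Δ₄₂, Δ₂₁, Δ₃₁, Δ₄₂ is a cocycle on N_02, and their cosets modulo B²(N_02,ℂ) form a basis of H²(N_02,ℂ); in particular dim H²(N_02,ℂ) = 6. -/
/-- The elementary bilinear multiplication on `ℂ^n` sending `(x, y)` to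
`(x_i * y_j) • e_k`; the concrete algebra below is a sum of such terms. -/
noncomputable def T {n : ℕ} (i j k : Fin n) :
    (Fin n → ℂ) →ₗ[ℂ] (Fin n → ℂ) →ₗ[ℂ] (Fin n → ℂ) :=
  LinearMap.mk₂ ℂ (fun x y => (x i * y j) • (Pi.single k 1 : Fin n → ℂ))
    (fun x x' y => by simp [add_mul, add_smul])
    (fun c x y => by simp [smul_eq_mul, smul_smul, mul_assoc])
    (fun x y y' => by simp [mul_add, add_smul])
    (fun c x y => by simp [smul_eq_mul, smul_smul, mul_left_comm])

/-- The bilinear form `Δ_{ij}` on `ℂ^n` (0-indexed): `Δ_{ij}(x,y) = x_i y_j`,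
so that `Δ_{ij}(e_l, e_m) = δ_{il} δ_{jm}`. -/
noncomputable def D {n : ℕ} (i j : Fin n) :
    (Fin n → ℂ) →ₗ[ℂ] (Fin n → ℂ) →ₗ[ℂ] ℂ :=
  LinearMap.mk₂ ℂ (fun x y => x i * y j)
    (fun x x' y => by simp [add_mul])
    (fun c x y => by simp [mul_assoc])
    (fun x y y' => by simp [mul_add])
    (fun c x y => by simp [smul_eq_mul, mul_left_comm])

/-- The cocycle condition: `θ(xy,z) = θ(xz,y)` and `θ(x,yz) = θ(y,xz)`. -/
def IsCocycle {A V : Type*} [AddCommGroup A] [Module ℂ A] [AddCommGroup V] [Module ℂ V]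
    (m : A →ₗ[ℂ] A →ₗ[ℂ] A) (θ : A →ₗ[ℂ] A →ₗ[ℂ] V) : Prop :=
  (∀ x y z : A, θ (m x y) z = θ (m x z) y) ∧ (∀ x y z : A, θ x (m y z) = θ y (m x z))

/-- `Z²(A,ℂ)`: the space of scalar-valued cocycles. -/
noncomputable def Zsub {A : Type*} [AddCommGroup A] [Module ℂ A]
    (m : A →ₗ[ℂ] A →ₗ[ℂ] A) : Submodule ℂ (A →ₗ[ℂ] A →ₗ[ℂ] ℂ) where
  carrier := {θ | IsCocycle m θ}
  add_mem' := by
    rintro θ η ⟨h1, h2⟩ ⟨g1, g2⟩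
    refine ⟨fun x y z => ?_, fun x y z => ?_⟩
    · simp only [LinearMap.add_apply]
      rw [h1 x y z, g1 x y z]
    · simp only [LinearMap.add_apply]
      rw [h2 x y z, g2 x y z]
  zero_mem' := ⟨fun x y z => by simp, fun x y z => by simp⟩
  smul_mem' := by
    rintro c θ ⟨h1, h2⟩
    refine ⟨fun x y z => ?_, fun x y z => ?_⟩
    · simp only [LinearMap.smul_apply]
      rw [h1 x y z]
    · simp only [LinearMap.smul_apply]
      rw [h2 x y z]

/-- The coboundary map `f ↦ δf = ((x,y) ↦ f(xy))`. -/
noncomputable def cobound {A : Type*} [AddCommGroup A] [Module ℂ A]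
    (m : A →ₗ[ℂ] A →ₗ[ℂ] A) : (A →ₗ[ℂ] ℂ) →ₗ[ℂ] (A →ₗ[ℂ] A →ₗ[ℂ] ℂ) where
  toFun f := m.compr₂ f
  map_add' f g := by ext x y; simp [LinearMap.compr₂_apply]
  map_smul' c f := by ext x y; simp [LinearMap.compr₂_apply]

/-- `B²(A,ℂ)`: the space of scalar-valued coboundaries. -/
noncomputable def Bsub {A : Type*} [AddCommGroup A] [Module ℂ A]
    (m : A →ₗ[ℂ] A →ₗ[ℂ] A) : Submodule ℂ (A →ₗ[ℂ] A →ₗ[ℂ] ℂ) :=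
  LinearMap.range (cobound m)

/-- The coset of a bilinear form modulo `B²(A,ℂ)`. -/
noncomputable def cls {A : Type*} [AddCommGroup A] [Module ℂ A]
    (m : A →ₗ[ℂ] A →ₗ[ℂ] A) (θ : A →ₗ[ℂ] A →ₗ[ℂ] ℂ) :
    (A →ₗ[ℂ] A →ₗ[ℂ] ℂ) ⧸ Bsub m :=
  (Bsub m).mkQ θ

/-- `H²(A,ℂ) = Z²(A,ℂ)/B²(A,ℂ)`, realized as the image of the cocycles in the
quotient of the space of all bilinear forms by the coboundaries. -/
noncomputable def H2 {A : Type*} [AddCommGroup A] [Module ℂ A]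
    (m : A →ₗ[ℂ] A →ₗ[ℂ] A) : Submodule ℂ ((A →ₗ[ℂ] A →ₗ[ℂ] ℂ) ⧸ Bsub m) :=
  (Zsub m).map (Bsub m).mkQ

/-- The algebra `N_02` on `ℂ^4`: `e_1 e_1 = e_3`, `e_2 e_2 = e_4`. -/
noncomputable def mul : (Fin 4 → ℂ) →ₗ[ℂ] (Fin 4 → ℂ) →ₗ[ℂ] (Fin 4 → ℂ) :=
  T 0 0 2 + T 1 1 3

/-- The forms `Δ₁₂+Δ₂₁, Δ₁₃+Δ₃₁, Δ₂₄+Δ₄₂, Δ₂₁, Δ₃₁, Δ₄₂` (0-indexed). -/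
noncomputable def forms : Fin 6 → ((Fin 4 → ℂ) →ₗ[ℂ] (Fin 4 → ℂ) →ₗ[ℂ] ℂ) :=
  ![D 0 1 + D 1 0, D 0 2 + D 2 0, D 1 3 + D 3 1, D 1 0, D 2 0, D 3 1]

theorem D_apply {n : ℕ} (i j : Fin n) (x y : Fin n → ℂ) : D i j x y = x i * y j := rfl

theorem mul_N02_apply (x y : Fin 4 → ℂ) : mul x y = ![0, 0, x 0 * y 0, x 1 * y 1] := by
  ext k
  fin_cases k <;> simp [mul, T]

theorem mul_single_single_of_ne {a b : Fin 4} (hab : a ≠ b) :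
    mul (Pi.single a 1) (Pi.single b 1) = 0 := by
  rw [mul_N02_apply]
  ext k
  fin_cases a <;> fin_cases b <;> fin_cases k <;> simp at hab ⊢

theorem isCocycle_forms (i : Fin 6) : IsCocycle mul (forms i) := by
  constructor <;> intro x y z <;> fin_cases i <;> simp [forms, D_apply, mul_N02_apply] <;> ring

theorem linearIndependent_cls_forms : LinearIndependent ℂ (fun i => cls mul (forms i)) := by
  rw [Fintype.linearIndependent_iff]
  intro g hg
  have hmem : ∑ i, g i • forms i ∈ Bsub mul := by
    rw [← (Bsub mul).ker_mkQ, LinearMap.mem_ker, map_sum]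
    simpa only [map_smul, cls] using hg
  obtain ⟨f, hf⟩ := hmem
  have key (a b : Fin 4) (hab : a ≠ b) :
      (∑ i, g i • forms i) (Pi.single a 1) (Pi.single b 1) = 0 := by
    rw [← hf]
    change f (mul _ _) = 0
    rw [mul_single_single_of_ne hab, map_zero]
  have h01 := key 0 1 (by decide)
  have h10 := key 1 0 (by decide)
  have h02 := key 0 2 (by decide)
  have h20 := key 2 0 (by decide)
  have h13 := key 1 3 (by decide)
  have h31 := key 3 1 (by decide)
  simp [Fin.sum_univ_succ, forms, D_apply] at h01 h10 h02 h20 h13 h31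
  intro i
  fin_cases i <;> simp_all

/-- A cocycle on `N_02` is a combination of eight of the forms `Δ_{ij}`, with its values on basis
vectors as coefficients. -/
theorem IsCocycle.eq_sum_D {θ : (Fin 4 → ℂ) →ₗ[ℂ] (Fin 4 → ℂ) →ₗ[ℂ] ℂ} (h : IsCocycle mul θ)
    {t : Fin 4 → Fin 4 → ℂ} (ht : ∀ a b, θ (Pi.single a 1) (Pi.single b 1) = t a b) :
    θ = t 0 0 • D 0 0 + t 1 1 • D 1 1 + t 0 1 • D 0 1 + t 1 0 • D 1 0 + t 0 2 • D 0 2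
      + t 2 0 • D 2 0 + t 1 3 • D 1 3 + t 3 1 • D 3 1 := by
  have m00 : mul (Pi.single 0 1) (Pi.single 0 1) = Pi.single 2 1 := by
    rw [mul_N02_apply]; ext k; fin_cases k <;> simp
  have m11 : mul (Pi.single 1 1) (Pi.single 1 1) = Pi.single 3 1 := by
    rw [mul_N02_apply]; ext k; fin_cases k <;> simp
  have l2 (b : Fin 4) (hb : b ≠ 0) : t 2 b = 0 := by
    rw [← ht, ← m00, h.1, mul_single_single_of_ne hb.symm]
    simp
  have l3 (b : Fin 4) (hb : b ≠ 1) : t 3 b = 0 := by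
    rw [← ht, ← m11, h.1, mul_single_single_of_ne hb.symm]
    simp
  have r2 (b : Fin 4) (hb : b ≠ 0) : t b 2 = 0 := by
    rw [← ht, ← m00, h.2, mul_single_single_of_ne hb]
    simp
  have r3 (b : Fin 4) (hb : b ≠ 1) : t b 3 = 0 := by
    rw [← ht, ← m11, h.2, mul_single_single_of_ne hb]
    simp
  ext a b
  simp only [LinearMap.comp_apply, LinearMap.coe_single, ht]
  fin_cases a <;> fin_cases b <;> simp [D_apply, l2, l3, r2, r3]

theorem span_cls_forms :
    Submodule.span ℂ (Set.range fun i => cls mul (forms i)) = H2 mul := by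
  apply le_antisymm
  · rw [Submodule.span_le]
    rintro _ ⟨i, rfl⟩
    exact Submodule.mem_map_of_mem (isCocycle_forms i)
  · rintro _ ⟨θ, hθ, rfl⟩
    obtain ⟨t, ht⟩ : ∃ t : Fin 4 → Fin 4 → ℂ,
        ∀ a b, θ (Pi.single a 1) (Pi.single b 1) = t a b := ⟨_, fun _ _ => rfl⟩
    let c : Fin 6 → ℂ :=
      ![t 0 1, t 0 2, t 1 3, t 1 0 - t 0 1, t 2 0 - t 0 2, t 3 1 - t 1 3]
    have hB : θ - ∑ i, c i • forms i ∈ Bsub mul := by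
      refine ⟨t 0 0 • LinearMap.proj 2 + t 1 1 • LinearMap.proj 3, ?_⟩
      refine LinearMap.ext₂ fun x y => ?_
      rw [IsCocycle.eq_sum_D hθ ht]
      simp [cobound, mul_N02_apply, Fin.sum_univ_succ, forms, c, D_apply]
      ring
    have hq : (Bsub mul).mkQ θ = ∑ i, c i • cls mul (forms i) := by
      rw [← sub_eq_zero, ← LinearMap.mem_ker.mp ((Bsub mul).ker_mkQ.symm ▸ hB), map_sub, map_sum]
      simp only [map_smul, cls]
    rw [hq]
    exact Submodule.sum_mem _ fun i _ =>
      Submodule.smul_mem _ _ (Submodule.subset_span ⟨i, rfl⟩)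

/-- The listed forms are cocycles, their cosets modulo `B²` form a basis of `H²`,
and in particular `dim H² = 6`. -/
theorem secondCohomology_N02 :
    (∀ i, IsCocycle mul (forms i)) ∧
    LinearIndependent ℂ (fun i => cls mul (forms i)) ∧
    Submodule.span ℂ (Set.range fun i => cls mul (forms i)) = H2 mul ∧
    Module.finrank ℂ (H2 mul) = 6 := by
  refine ⟨isCocycle_forms, linearIndependent_cls_forms, span_cls_forms, ?_⟩
  rw [← span_cls_forms, finrank_span_eq_card linearIndependent_cls_forms, Fintype.card_fin]
end

section
/- Let B₀₁ be the 5-dimensional ℂ-algebra with basis e_1,e_2,e_3,e_4,e_5 and only nonzero basis products e_1e_1 = e_2, e_2e_1 = e_5, e_1e_4 = e_5, e_4e_1 = e_5, e_3e_3 = e_5. Then B₀₁ is a bicommutative algebra; it is not commutative (e_1e_2 = 0 ≠ e_2e_1); it is not 2-step nilpotent, since (e_1e_1)e_1 = e_5 ≠ 0; and it is nilpotent: every product of four elements of B₀₁, under any bracketing, equals zero. -/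
/-- Bicommutativity of a bilinear multiplication: `(xy)z = (xz)y` and `x(yz) = y(xz)`. -/
def IsBicommutative {A : Type*} [AddCommGroup A] [Module ℂ A]
    (m : A →ₗ[ℂ] A →ₗ[ℂ] A) : Prop :=
  (∀ x y z : A, m (m x y) z = m (m x z) y) ∧ (∀ x y z : A, m x (m y z) = m y (m x z))

/-- The standard basis vector `e_{i+1}` of `ℂ^5` (`i : Fin 5` is 0-indexed). -/
noncomputable def e (i : Fin 5) : Fin 5 → ℂ := Pi.single i 1

/-- The algebra `B₀₁` on `ℂ^5`: `e_1 e_1 = e_2`, `e_2 e_1 = e_5`, `e_1 e_4 = e_5`,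
`e_4 e_1 = e_5`, `e_3 e_3 = e_5` (other basis products zero). -/
noncomputable def mulB01 : (Fin 5 → ℂ) →ₗ[ℂ] (Fin 5 → ℂ) →ₗ[ℂ] (Fin 5 → ℂ) :=
  T 0 0 1 + T 1 0 4 + T 0 3 4 + T 3 0 4 + T 2 2 4

theorem mulB01_apply (x y : Fin 5 → ℂ) :
    mulB01 x y = ![0, x 0 * y 0, 0, 0, x 1 * y 0 + x 0 * y 3 + x 3 * y 0 + x 2 * y 2] := by
  ext i
  fin_cases i <;> simp [mulB01, T]

theorem mulB01_mul_left (x y z : Fin 5 → ℂ) :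
    mulB01 (mulB01 x y) z = (x 0 * y 0 * z 0) • e 4 := by
  ext i
  fin_cases i <;> simp [mulB01_apply, e]

theorem mulB01_mul_right (x y z : Fin 5 → ℂ) : mulB01 x (mulB01 y z) = 0 := by
  ext i
  fin_cases i <;> simp [mulB01_apply]

theorem mulB01_e_four_left (x : Fin 5 → ℂ) : mulB01 (e 4) x = 0 := by
  ext i
  fin_cases i <;> simp [mulB01_apply, e]

theorem e_ne_zero (i : Fin 5) : e i ≠ 0 := by
  simp [e]

/-- `B₀₁` is bicommutative; it is not commutative (`e_1 e_2 = 0 ≠ e_2 e_1 = e_5`);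
it is not 2-step nilpotent (`(e_1 e_1) e_1 = e_5 ≠ 0`); and it is nilpotent:
every product of four elements, under any bracketing, vanishes. -/
theorem B01_bicommutative_nilpotent_properties :
    IsBicommutative mulB01 ∧
    (mulB01 (e 0) (e 1) = 0 ∧ mulB01 (e 1) (e 0) = e 4 ∧ ¬(∀ x y, mulB01 x y = mulB01 y x)) ∧
    (mulB01 (mulB01 (e 0) (e 0)) (e 0) = e 4 ∧ (e 4 : Fin 5 → ℂ) ≠ 0 ∧
      ¬(∀ x y z, mulB01 (mulB01 x y) z = 0 ∧ mulB01 x (mulB01 y z) = 0)) ∧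
    (∀ w x y z : Fin 5 → ℂ,
      mulB01 (mulB01 (mulB01 w x) y) z = 0 ∧
      mulB01 (mulB01 w (mulB01 x y)) z = 0 ∧
      mulB01 (mulB01 w x) (mulB01 y z) = 0 ∧
      mulB01 w (mulB01 (mulB01 x y) z) = 0 ∧
      mulB01 w (mulB01 x (mulB01 y z)) = 0) := by
  have h01 : mulB01 (e 0) (e 1) = 0 := by
    ext i
    fin_cases i <;> simp [mulB01_apply, e]
  have h10 : mulB01 (e 1) (e 0) = e 4 := by
    ext i
    fin_cases i <;> simp [mulB01_apply, e]
  have h000 : mulB01 (mulB01 (e 0) (e 0)) (e 0) = e 4 := by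
    rw [mulB01_mul_left]
    simp [e]
  refine ⟨⟨fun x y z => ?_, fun x y z => ?_⟩, ⟨h01, h10, fun h => ?_⟩,
    ⟨h000, e_ne_zero 4, fun h => ?_⟩, fun w x y z => ⟨?_, ?_, ?_, ?_, ?_⟩⟩
  · rw [mulB01_mul_left, mulB01_mul_left, mul_right_comm]
  · rw [mulB01_mul_right, mulB01_mul_right]
  · exact e_ne_zero 4 (by rw [← h10, ← h, h01])
  · exact e_ne_zero 4 (h000 ▸ (h (e 0) (e 0) (e 0)).1)
  · rw [mulB01_mul_left w x y, map_smul, LinearMap.smul_apply, mulB01_e_four_left, smul_zero]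
  · rw [mulB01_mul_right, map_zero, LinearMap.zero_apply]
  · exact mulB01_mul_right _ _ _
  · exact mulB01_mul_right _ _ _
  · exact mulB01_mul_right _ _ _
end
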